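/- arXiv:1208.0434 — 2 statements merged into one kernel-verified Lean document; each statement's English description precedes it below -/
import Mathlib

section
/- For every p ∈ [1,∞) and all metric measure spaces (X₀,d₀,m₀) and (X₁,d₁,m₁), the L^p-distortion distance admits the parametrization representation: DD_p((X₀,d₀,m₀),(X₁,d₁,m₁)) equals the infimum, over all Borel maps ψ₀ : [0,1] → X₀ with (ψ₀)_*Leb = m₀ and ψ₁ : [0,1] → X₁ with (ψ₁)_*Leb = m₁, of (∫₀¹∫₀¹ |d₀(ψ₀(s),ψ₀(t)) − d₁(ψ₁(s),ψ₁(t))|^p ds dt)^{1/p}, where Leb denotes Lebesgue measure on [0,1]. -/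
open MeasureTheory ENNReal

/-- The set of couplings of two measures: measures on the product whose marginals
are the two given measures. -/
def Cpl {α β : Type*} [MeasurableSpace α] [MeasurableSpace β]
    (m₀ : Measure α) (m₁ : Measure β) : Set (Measure (α × β)) :=
  {μ | μ.map Prod.fst = m₀ ∧ μ.map Prod.snd = m₁}

/-- The `L^p`-distortion of a coupling `μ` of two gauged (e.g. metric) measure
spaces with gauges `f₀` and `f₁`:
`(∬ |f₀(x₀,y₀) − f₁(x₁,y₁)|^p dμ dμ)^(1/p)`. -/
noncomputable def distortionP {α β : Type*} [MeasurableSpace α] [MeasurableSpace β] (p : ℝ)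
    (f₀ : α → α → ℝ) (f₁ : β → β → ℝ) (μ : Measure (α × β)) : ℝ≥0∞ :=
  (∫⁻ z, ∫⁻ w, ENNReal.ofReal (|f₀ z.1 w.1 - f₁ z.2 w.2| ^ p) ∂μ ∂μ) ^ (1 / p)

/-- The `L^p`-distortion distance between two gauged (e.g. metric) measure spaces:
the infimum of the `L^p`-distortion over all couplings. -/
noncomputable def DDp {α β : Type*} [MeasurableSpace α] [MeasurableSpace β] (p : ℝ)
    (f₀ : α → α → ℝ) (f₁ : β → β → ℝ) (m₀ : Measure α) (m₁ : Measure β) : ℝ≥0∞ :=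
  ⨅ μ ∈ Cpl m₀ m₁, distortionP p f₀ f₁ μ

/-- Lebesgue measure restricted to the unit interval `[0,1]`. -/
noncomputable def Leb01 : Measure ℝ := volume.restrict (Set.Icc (0 : ℝ) 1)

theorem map_projIcc_Leb01 :
    Leb01.map (Set.projIcc (0 : ℝ) 1 zero_le_one) = (volume : Measure unitInterval) := by
  have h : Leb01 = (volume : Measure unitInterval).map Subtype.val := by
    rw [Leb01, ← map_comap_subtype_coe measurableSet_Icc]; rfl
  rw [h, Measure.map_map (continuous_projIcc.measurable) measurable_subtype_coe]
  have : Set.projIcc (0 : ℝ) 1 zero_le_one ∘ Subtype.val = (id : unitInterval → unitInterval) :=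
    funext fun x => Set.projIcc_val zero_le_one x
  rw [this, Measure.map_id]

instance isProbabilityMeasure_Leb01 : IsProbabilityMeasure Leb01 :=
  ⟨by simp [Leb01]⟩

/-- Every probability measure on a standard Borel space is parametrized by the unit interval. -/
theorem exists_measurable_map_Leb01_eq {α : Type*} [MeasurableSpace α] [StandardBorelSpace α]
    (μ : Measure α) [IsProbabilityMeasure μ] :
    ∃ ψ : ℝ → α, Measurable ψ ∧ Leb01.map ψ = μ := by
  have : Nonempty α := nonempty_of_isProbabilityMeasure μ
  obtain ⟨f, hf, hfμ⟩ := μ.exists_measurable_map_eq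
  refine ⟨f ∘ Set.projIcc (0 : ℝ) 1 zero_le_one, hf.comp continuous_projIcc.measurable, ?_⟩
  rw [← Measure.map_map hf continuous_projIcc.measurable, map_projIcc_Leb01, hfμ]

/-- The distortion of a coupling given as a pushforward, as an integral over the source. -/
theorem distortionP_map {Ω α β : Type*} [MeasurableSpace Ω] [MeasurableSpace α]
    [MeasurableSpace β] (p : ℝ) {f₀ : α → α → ℝ} {f₁ : β → β → ℝ}
    (hf₀ : Measurable (Function.uncurry f₀)) (hf₁ : Measurable (Function.uncurry f₁))
    (ν : Measure Ω) [SFinite ν] {ψ₀ : Ω → α} {ψ₁ : Ω → β}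
    (hψ₀ : Measurable ψ₀) (hψ₁ : Measurable ψ₁) :
    distortionP p f₀ f₁ (ν.map fun s => (ψ₀ s, ψ₁ s)) =
      (∫⁻ s, ∫⁻ t, ENNReal.ofReal (|f₀ (ψ₀ s) (ψ₀ t) - f₁ (ψ₁ s) (ψ₁ t)| ^ p) ∂ν ∂ν)
        ^ (1 / p) := by
  have hψ : Measurable fun s => (ψ₀ s, ψ₁ s) := hψ₀.prodMk hψ₁
  have hF : Measurable fun q : (α × β) × (α × β) =>
      ENNReal.ofReal (|f₀ q.1.1 q.2.1 - f₁ q.1.2 q.2.2| ^ p) := by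
    have h₀ : Measurable fun q : (α × β) × (α × β) => f₀ q.1.1 q.2.1 :=
      hf₀.comp (f := fun q : (α × β) × (α × β) => (q.1.1, q.2.1)) (by fun_prop)
    have h₁ : Measurable fun q : (α × β) × (α × β) => f₁ q.1.2 q.2.2 :=
      hf₁.comp (f := fun q : (α × β) × (α × β) => (q.1.2, q.2.2)) (by fun_prop)
    exact (((h₀.sub h₁).abs).pow_const p).ennreal_ofReal
  rw [distortionP, lintegral_map hF.lintegral_prod_right' hψ]
  congr 2 with s
  exact lintegral_map (hF.comp measurable_prodMk_left) hψ

/-- For `p ∈ [1,∞)`, the `L^p`-distortion distance between two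
metric measure spaces equals the infimum, over all pairs of Borel parametrizations
`ψ₀ : [0,1] → X₀`, `ψ₁ : [0,1] → X₁` (pushing Lebesgue measure forward to `m₀`
resp. `m₁`), of `(∫₀¹∫₀¹ |d₀(ψ₀ s, ψ₀ t) − d₁(ψ₁ s, ψ₁ t)|^p ds dt)^(1/p)`. -/
theorem DDp_eq_iInf_parametrizations
    {X₀ X₁ : Type*}
    [MetricSpace X₀] [CompleteSpace X₀] [TopologicalSpace.SeparableSpace X₀]
    [MeasurableSpace X₀] [BorelSpace X₀]
    [MetricSpace X₁] [CompleteSpace X₁] [TopologicalSpace.SeparableSpace X₁]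
    [MeasurableSpace X₁] [BorelSpace X₁]
    (p : ℝ) (hp : 1 ≤ p)
    (m₀ : Measure X₀) (m₁ : Measure X₁)
    [IsProbabilityMeasure m₀] [IsProbabilityMeasure m₁] :
    DDp p dist dist m₀ m₁ =
      ⨅ (ψ₀ : ℝ → X₀) (ψ₁ : ℝ → X₁) (_ : Measurable ψ₀) (_ : Measurable ψ₁)
        (_ : Leb01.map ψ₀ = m₀) (_ : Leb01.map ψ₁ = m₁),
        (∫⁻ s, ∫⁻ t,
            ENNReal.ofReal (|dist (ψ₀ s) (ψ₀ t) - dist (ψ₁ s) (ψ₁ t)| ^ p)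
              ∂Leb01 ∂Leb01) ^ (1 / p) := by
  have : SecondCountableTopology X₀ := UniformSpace.secondCountable_of_separable X₀
  have : SecondCountableTopology X₁ := UniformSpace.secondCountable_of_separable X₁
  have h₀ : Measurable (Function.uncurry (dist : X₀ → X₀ → ℝ)) := measurable_dist
  have h₁ : Measurable (Function.uncurry (dist : X₁ → X₁ → ℝ)) := measurable_dist
  refine le_antisymm ?_ ?_
  · refine le_iInf fun ψ₀ => le_iInf fun ψ₁ => le_iInf fun hψ₀ => le_iInf fun hψ₁ =>
      le_iInf fun hm₀ => le_iInf fun hm₁ => ?_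
    rw [← distortionP_map p h₀ h₁ Leb01 hψ₀ hψ₁]
    refine iInf₂_le _ ⟨?_, ?_⟩
    · rw [Measure.map_map measurable_fst (hψ₀.prodMk hψ₁)]
      exact hm₀
    · rw [Measure.map_map measurable_snd (hψ₀.prodMk hψ₁)]
      exact hm₁
  · refine le_iInf₂ fun μ hμ => ?_
    have : IsProbabilityMeasure μ := by
      have : IsProbabilityMeasure (μ.map Prod.fst) := by rw [hμ.1]; infer_instance
      exact Measure.isProbabilityMeasure_of_map Prod.fst
    obtain ⟨ψ, hψ, hψμ⟩ := exists_measurable_map_Leb01_eq μ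
    have hm₀ : Leb01.map (fun s => (ψ s).1) = m₀ := by
      rw [← hμ.1, ← hψμ, Measure.map_map measurable_fst hψ]
      rfl
    have hm₁ : Leb01.map (fun s => (ψ s).2) = m₁ := by
      rw [← hμ.2, ← hψμ, Measure.map_map measurable_snd hψ]
      rfl
    have hd := distortionP_map p h₀ h₁ Leb01 hψ.fst hψ.snd
    rw [show (fun s => ((ψ s).1, (ψ s).2)) = ψ from rfl, hψμ] at hd
    rw [hd]
    exact iInf_le_of_le (fun s => (ψ s).1) <| iInf_le_of_le (fun s => (ψ s).2) <|
      iInf_le_of_le hψ.fst <| iInf_le_of_le hψ.snd <| iInf_le_of_le hm₀ <| iInf_le _ hm₁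
end

section
/- Cone law: let (X,d,m) and (X',d',m') be metric measure spaces of L²-size 1, i.e. ∫∫ d² dm dm = 1 and ∫∫ d'² dm' dm' = 1. Then for all s, t ∈ (0,∞), DD((X, s·d, m),(X', t·d', m'))² = s² + t² + s·t·( DD((X,d,m),(X',d',m'))² − 2 ). Equivalently, the quantity (1/(2st))·[DD((X, s·d, m),(X', t·d', m'))² − s² − t²] is independent of s and t; in particular the space of metric measure spaces with the L²-distortion distance is a metric cone over its unit sphere. -/
open MeasureTheory ENNReal

/-- The `L²`-distortion of a coupling `μ` of two gauged (e.g. metric) measure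
spaces with gauges `f₀` and `f₁`:
`(∬ |f₀(x₀,y₀) − f₁(x₁,y₁)|² dμ dμ)^(1/2)`. -/
noncomputable def distortion2 {α β : Type*} [MeasurableSpace α] [MeasurableSpace β]
    (f₀ : α → α → ℝ) (f₁ : β → β → ℝ) (μ : Measure (α × β)) : ℝ≥0∞ :=
  (∫⁻ z, ∫⁻ w, ENNReal.ofReal ((f₀ z.1 w.1 - f₁ z.2 w.2) ^ 2) ∂μ ∂μ) ^ (1 / 2 : ℝ)

/-- The `L²`-distortion distance between two gauged (e.g. metric) measure spaces:
the infimum of the `L²`-distortion over all couplings. -/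
noncomputable def DD2 {α β : Type*} [MeasurableSpace α] [MeasurableSpace β]
    (f₀ : α → α → ℝ) (f₁ : β → β → ℝ) (m₀ : Measure α) (m₁ : Measure β) : ℝ≥0∞ :=
  ⨅ μ ∈ Cpl m₀ m₁, distortion2 f₀ f₁ μ

theorem lintegral_prod_self_comp_of_map_eq {α β : Type*} [MeasurableSpace α] [MeasurableSpace β]
    {μ : Measure α} {ν : Measure β} [SFinite μ] {p : α → β} (hp : Measurable p)
    (hμ : μ.map p = ν) {g : β → β → ℝ≥0∞} (hg : Measurable (Function.uncurry g)) :
    ∫⁻ q, g (p q.1) (p q.2) ∂μ.prod μ = ∫⁻ x, ∫⁻ y, g x y ∂ν ∂ν := by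
  subst hμ
  refine Eq.trans ?_ (lintegral_prod (Function.uncurry g) hg.aemeasurable)
  rw [Measure.map_prod_map μ μ hp hp, lintegral_map hg (hp.prodMap hp)]
  rfl

theorem isProbabilityMeasure_of_mem_Cpl {α β : Type*} [MeasurableSpace α] [MeasurableSpace β]
    {m₀ : Measure α} {m₁ : Measure β} [IsProbabilityMeasure m₀] {μ : Measure (α × β)}
    (hμ : μ ∈ Cpl m₀ m₁) : IsProbabilityMeasure μ := by
  refine ⟨?_⟩
  rw [← Set.preimage_univ (f := Prod.fst), ← Measure.map_apply measurable_fst .univ, hμ.1,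
    measure_univ]

theorem prod_mem_Cpl {α β : Type*} [MeasurableSpace α] [MeasurableSpace β]
    (m₀ : Measure α) (m₁ : Measure β) [IsProbabilityMeasure m₀] [IsProbabilityMeasure m₁] :
    m₀.prod m₁ ∈ Cpl m₀ m₁ := by
  simp [Cpl]

theorem distortion2_sq {α β : Type*} [MeasurableSpace α] [MeasurableSpace β]
    (f₀ : α → α → ℝ) (f₁ : β → β → ℝ) (μ : Measure (α × β)) :
    distortion2 f₀ f₁ μ ^ 2 =
      ∫⁻ z, ∫⁻ w, ENNReal.ofReal ((f₀ z.1 w.1 - f₁ z.2 w.2) ^ 2) ∂μ ∂μ := by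
  rw [distortion2, ← ENNReal.rpow_natCast, ← ENNReal.rpow_mul]
  norm_num

theorem distortion2_sq_eq_lintegral_prod {α β : Type*} [MeasurableSpace α] [MeasurableSpace β]
    {f₀ : α → α → ℝ} {f₁ : β → β → ℝ} (hf₀ : Measurable (Function.uncurry f₀))
    (hf₁ : Measurable (Function.uncurry f₁)) (μ : Measure (α × β)) [SFinite μ] :
    distortion2 f₀ f₁ μ ^ 2 =
      ∫⁻ q, ENNReal.ofReal ((f₀ q.1.1 q.2.1 - f₁ q.1.2 q.2.2) ^ 2) ∂μ.prod μ := by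
  have ha : Measurable fun q : (α × β) × (α × β) => f₀ q.1.1 q.2.1 :=
    hf₀.comp (measurable_fst.fst.prodMk measurable_snd.fst)
  have hb : Measurable fun q : (α × β) × (α × β) => f₁ q.1.2 q.2.2 :=
    hf₁.comp (measurable_fst.snd.prodMk measurable_snd.snd)
  rw [distortion2_sq, lintegral_prod _ (by fun_prop)]

theorem DD2_sq {α β : Type*} [MeasurableSpace α] [MeasurableSpace β]
    (f₀ : α → α → ℝ) (f₁ : β → β → ℝ) (m₀ : Measure α) (m₁ : Measure β) :
    DD2 f₀ f₁ m₀ m₁ ^ 2 = ⨅ μ : Cpl m₀ m₁, distortion2 f₀ f₁ μ ^ 2 := by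
  have h := (ENNReal.orderIsoRpow 2 two_pos).map_iInf
    fun μ : Cpl m₀ m₁ => distortion2 f₀ f₁ (μ : Measure (α × β))
  simpa only [ENNReal.orderIsoRpow_apply, ENNReal.rpow_two, DD2, iInf_subtype'] using h

section GaugedSpaces

variable {α β : Type*} [MeasurableSpace α] [MeasurableSpace β]
  {m₀ : Measure α} {m₁ : Measure β} [IsProbabilityMeasure m₀]
  {f₀ : α → α → ℝ} {f₁ : β → β → ℝ}

/-- The polarization identity behind the cone law, with all terms nonnegative. -/
theorem distortion2_sq_smul_add (hf₀ : Measurable (Function.uncurry f₀))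
    (hf₁ : Measurable (Function.uncurry f₁)) {s t : ℝ} (hs : 0 ≤ s) (ht : 0 ≤ t)
    {μ : Measure (α × β)} (hμ : μ ∈ Cpl m₀ m₁) :
    distortion2 (fun x y => s * f₀ x y) (fun x y => t * f₁ x y) μ ^ 2 +
        ENNReal.ofReal (s * t) * ((∫⁻ x, ∫⁻ y, ENNReal.ofReal (f₀ x y ^ 2) ∂m₀ ∂m₀) +
          ∫⁻ x, ∫⁻ y, ENNReal.ofReal (f₁ x y ^ 2) ∂m₁ ∂m₁) =
      ENNReal.ofReal (s ^ 2) * (∫⁻ x, ∫⁻ y, ENNReal.ofReal (f₀ x y ^ 2) ∂m₀ ∂m₀) +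
        ENNReal.ofReal (t ^ 2) * (∫⁻ x, ∫⁻ y, ENNReal.ofReal (f₁ x y ^ 2) ∂m₁ ∂m₁) +
        ENNReal.ofReal (s * t) * distortion2 f₀ f₁ μ ^ 2 := by
  have := isProbabilityMeasure_of_mem_Cpl hμ
  have ha : Measurable fun q : (α × β) × (α × β) => f₀ q.1.1 q.2.1 :=
    hf₀.comp (measurable_fst.fst.prodMk measurable_snd.fst)
  have hb : Measurable fun q : (α × β) × (α × β) => f₁ q.1.2 q.2.2 :=
    hf₁.comp (measurable_fst.snd.prodMk measurable_snd.snd)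
  rw [distortion2_sq_eq_lintegral_prod (hf₀.const_mul s) (hf₁.const_mul t),
    distortion2_sq_eq_lintegral_prod hf₀ hf₁,
    ← lintegral_prod_self_comp_of_map_eq measurable_fst hμ.1
      (g := fun x y => ENNReal.ofReal (f₀ x y ^ 2)) (hf₀.pow_const 2).ennreal_ofReal,
    ← lintegral_prod_self_comp_of_map_eq measurable_snd hμ.2
      (g := fun x y => ENNReal.ofReal (f₁ x y ^ 2)) (hf₁.pow_const 2).ennreal_ofReal,
    ← lintegral_add_left (by fun_prop), ← lintegral_const_mul _ (by fun_prop),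
    ← lintegral_const_mul _ (by fun_prop), ← lintegral_const_mul _ (by fun_prop),
    ← lintegral_const_mul _ (by fun_prop), ← lintegral_add_left (by fun_prop),
    ← lintegral_add_left (by fun_prop), ← lintegral_add_left (by fun_prop)]
  refine lintegral_congr fun q => ?_
  have hst : 0 ≤ s * t := mul_nonneg hs ht
  rw [← ENNReal.ofReal_add (by positivity) (by positivity), ← ENNReal.ofReal_mul (by positivity),
    ← ENNReal.ofReal_mul (by positivity), ← ENNReal.ofReal_mul (by positivity),
    ← ENNReal.ofReal_mul (by positivity), ← ENNReal.ofReal_add (by positivity) (by positivity),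
    ← ENNReal.ofReal_add (by positivity) (by positivity),
    ← ENNReal.ofReal_add (by positivity) (by positivity)]
  ring_nf

variable [IsProbabilityMeasure m₁]

/-- The cone law for measurable gauges of arbitrary size, with all terms nonnegative. -/
theorem DD2_sq_smul_add (hf₀ : Measurable (Function.uncurry f₀))
    (hf₁ : Measurable (Function.uncurry f₁)) {s t : ℝ} (hs : 0 ≤ s) (ht : 0 ≤ t) :
    DD2 (fun x y => s * f₀ x y) (fun x y => t * f₁ x y) m₀ m₁ ^ 2 +
        ENNReal.ofReal (s * t) * ((∫⁻ x, ∫⁻ y, ENNReal.ofReal (f₀ x y ^ 2) ∂m₀ ∂m₀) +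
          ∫⁻ x, ∫⁻ y, ENNReal.ofReal (f₁ x y ^ 2) ∂m₁ ∂m₁) =
      ENNReal.ofReal (s ^ 2) * (∫⁻ x, ∫⁻ y, ENNReal.ofReal (f₀ x y ^ 2) ∂m₀ ∂m₀) +
        ENNReal.ofReal (t ^ 2) * (∫⁻ x, ∫⁻ y, ENNReal.ofReal (f₁ x y ^ 2) ∂m₁ ∂m₁) +
        ENNReal.ofReal (s * t) * DD2 f₀ f₁ m₀ m₁ ^ 2 := by
  have : Nonempty (Cpl m₀ m₁) := ⟨⟨_, prod_mem_Cpl m₀ m₁⟩⟩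
  rw [DD2_sq, DD2_sq, ENNReal.iInf_add, ENNReal.mul_iInf (by simp), ENNReal.add_iInf]
  exact iInf_congr fun μ => distortion2_sq_smul_add hf₀ hf₁ hs ht μ.2

theorem DD2_ne_top (hf₀ : Measurable (Function.uncurry f₀))
    (hf₁ : Measurable (Function.uncurry f₁))
    (h₀ : (∫⁻ x, ∫⁻ y, ENNReal.ofReal (f₀ x y ^ 2) ∂m₀ ∂m₀) ≠ ∞)
    (h₁ : (∫⁻ x, ∫⁻ y, ENNReal.ofReal (f₁ x y ^ 2) ∂m₁ ∂m₁) ≠ ∞) :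
    DD2 f₀ f₁ m₀ m₁ ≠ ∞ := by
  have hle : distortion2 f₀ f₁ (m₀.prod m₁) ^ 2 ≤
      2 * (∫⁻ x, ∫⁻ y, ENNReal.ofReal (f₀ x y ^ 2) ∂m₀ ∂m₀) +
        2 * ∫⁻ x, ∫⁻ y, ENNReal.ofReal (f₁ x y ^ 2) ∂m₁ ∂m₁ := by
    have ha : Measurable fun q : (α × β) × (α × β) => f₀ q.1.1 q.2.1 :=
      hf₀.comp (measurable_fst.fst.prodMk measurable_snd.fst)
    have hb : Measurable fun q : (α × β) × (α × β) => f₁ q.1.2 q.2.2 :=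
      hf₁.comp (measurable_fst.snd.prodMk measurable_snd.snd)
    have hμ := prod_mem_Cpl m₀ m₁
    rw [distortion2_sq_eq_lintegral_prod hf₀ hf₁,
      ← lintegral_prod_self_comp_of_map_eq measurable_fst hμ.1
        (g := fun x y => ENNReal.ofReal (f₀ x y ^ 2)) (hf₀.pow_const 2).ennreal_ofReal,
      ← lintegral_prod_self_comp_of_map_eq measurable_snd hμ.2
        (g := fun x y => ENNReal.ofReal (f₁ x y ^ 2)) (hf₁.pow_const 2).ennreal_ofReal,
      ← lintegral_const_mul _ (by fun_prop), ← lintegral_const_mul _ (by fun_prop),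
      ← lintegral_add_left (by fun_prop)]
    refine lintegral_mono fun q => ?_
    rw [← ENNReal.ofReal_ofNat, ← ENNReal.ofReal_mul zero_le_two, ← ENNReal.ofReal_mul zero_le_two,
      ← ENNReal.ofReal_add (by positivity) (by positivity)]
    exact ENNReal.ofReal_le_ofReal (by nlinarith [sq_nonneg (f₀ q.1.1 q.2.1 + f₁ q.1.2 q.2.2)])
  have hsq : distortion2 f₀ f₁ (m₀.prod m₁) ^ 2 ≠ ∞ := ne_top_of_le_ne_top (by finiteness) hle
  exact ne_top_of_le_ne_top (fun h => hsq (by simp [h])) (iInf₂_le _ (prod_mem_Cpl m₀ m₁))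

end GaugedSpaces

/-- **Cone law.** If `(X,d,m)` and `(X',d',m')` are metric measure
spaces of `L²`-size 1, then for all `s, t ∈ (0,∞)`:
`DD((X,s·d,m),(X',t·d',m'))² = s² + t² + s·t·(DD((X,d,m),(X',d',m'))² − 2)`.
In particular the space of metric measure spaces with the `L²`-distortion distance
is a metric cone over its unit sphere. -/
theorem DD2_cone_law
    {X X' : Type*}
    [MetricSpace X] [CompleteSpace X] [TopologicalSpace.SeparableSpace X]
    [MeasurableSpace X] [BorelSpace X]
    [MetricSpace X'] [CompleteSpace X'] [TopologicalSpace.SeparableSpace X']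
    [MeasurableSpace X'] [BorelSpace X']
    (m : Measure X) (m' : Measure X')
    [IsProbabilityMeasure m] [IsProbabilityMeasure m']
    (hsize : (∫⁻ x, ∫⁻ y, ENNReal.ofReal (dist x y ^ 2) ∂m ∂m) = 1)
    (hsize' : (∫⁻ x, ∫⁻ y, ENNReal.ofReal (dist x y ^ 2) ∂m' ∂m') = 1)
    (s t : ℝ) (hs : 0 < s) (ht : 0 < t) :
    (DD2 (fun x y => s * dist x y) (fun x y => t * dist x y) m m').toReal ^ 2 =
      s ^ 2 + t ^ 2 + s * t * ((DD2 dist dist m m').toReal ^ 2 - 2) := by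
  have : SecondCountableTopology X := UniformSpace.secondCountable_of_separable X
  have : SecondCountableTopology X' := UniformSpace.secondCountable_of_separable X'
  have hd : Measurable (Function.uncurry (dist : X → X → ℝ)) := measurable_dist
  have hd' : Measurable (Function.uncurry (dist : X' → X' → ℝ)) := measurable_dist
  have hfin : DD2 (dist : X → X → ℝ) (dist : X' → X' → ℝ) m m' ≠ ∞ :=
    DD2_ne_top hd hd' (hsize.trans_ne one_ne_top) (hsize'.trans_ne one_ne_top)
  have key := DD2_sq_smul_add (m₀ := m) (m₁ := m') hd hd' hs.le ht.le
  rw [hsize, hsize'] at key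
  have hfin' : DD2 (fun x y : X => s * dist x y) (fun x y : X' => t * dist x y) m m' ^ 2 ≠ ∞ := by
    refine ne_top_of_le_ne_top ?_ (le_self_add.trans key.le)
    finiteness
  have hreal := congrArg ENNReal.toReal key
  rw [ENNReal.toReal_add hfin' (by finiteness), ENNReal.toReal_add (by finiteness) (by finiteness),
    ENNReal.toReal_add (by finiteness) (by finiteness)] at hreal
  simp only [ENNReal.toReal_mul, ENNReal.toReal_pow, ENNReal.toReal_ofReal (sq_nonneg s),
    ENNReal.toReal_ofReal (sq_nonneg t), ENNReal.toReal_ofReal (mul_pos hs ht).le, mul_one,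
    one_add_one_eq_two, ENNReal.toReal_ofNat] at hreal
  linarith
end
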